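/- Suppose V̂ satisfies the Bellman equation for π. Then for every action a and every k with 1 ≤ k ≤ N−1: Var_π((1(A_0=a)/π(a|s))·δ_k | S_0 = s) = Σ_{s' : p_k(s'|s) > 0} (p_k(s'|s,a)/π(a|s))·E_π[δ_k² | S_0 = s, S_k = s']. -/

import Mathlib

open Finset

attribute [local instance] Classical.propDecidable

namespace HCA

/-- A trajectory of horizon `N`: the actions taken at steps `0, …, N-1` and the
states reached after each step (the start state is fixed separately). -/
abbrev Traj (S A : Type*) (N : ℕ) : Type _ := (Fin N → A) × (Fin N → S)

variable {S A : Type*} [Fintype S] [Fintype A] [Nonempty S] [Nonempty A]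

/-- The state `S_k` of a trajectory with start state `s`. -/
def st {N : ℕ} (s : S) (τ : Traj S A N) : ℕ → S
  | 0 => s
  | k + 1 => if h : k < N then τ.2 ⟨k, h⟩ else s

/-- The action `A_k` of a trajectory. -/
noncomputable def ac {N : ℕ} (τ : Traj S A N) (k : ℕ) : A :=
  if h : k < N then τ.1 ⟨k, h⟩ else Classical.arbitrary A

/-- The probability `P_π(τ) = ∏_{k=0}^{N-1} π(A_k|S_k)·P(S_{k+1}|S_k,A_k)` of a
trajectory starting at `s`. -/
noncomputable def trajP (π : S → A → ℝ) (P : S → A → S → ℝ) (s : S) (N : ℕ)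
    (τ : Traj S A N) : ℝ :=
  ∏ k : Fin N, π (st s τ k) (τ.1 k) * P (st s τ k) (τ.1 k) (st s τ (k + 1))

/-- Expectation `E_π[f | S_0 = s]` over trajectories. -/
noncomputable def expct (π : S → A → ℝ) (P : S → A → S → ℝ) (s : S) (N : ℕ)
    (f : Traj S A N → ℝ) : ℝ :=
  ∑ τ : Traj S A N, trajP π P s N τ * f τ

/-- Variance `Var_π(f | S_0 = s)` over trajectories. -/
noncomputable def vr (π : S → A → ℝ) (P : S → A → S → ℝ) (s : S) (N : ℕ)
    (f : Traj S A N → ℝ) : ℝ :=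
  expct π P s N (fun τ => (f τ - expct π P s N f) ^ 2)

/-- Covariance `cov_π(f, g | S_0 = s)` over trajectories. -/
noncomputable def cv (π : S → A → ℝ) (P : S → A → S → ℝ) (s : S) (N : ℕ)
    (f g : Traj S A N → ℝ) : ℝ :=
  expct π P s N (fun τ => (f τ - expct π P s N f) * (g τ - expct π P s N g))

/-- Probability `P_π(E | S_0 = s)` of an event `E` on trajectories. -/
noncomputable def prE (π : S → A → ℝ) (P : S → A → S → ℝ) (s : S) (N : ℕ)
    (E : Traj S A N → Prop) : ℝ :=
  ∑ τ : Traj S A N, if E τ then trajP π P s N τ else 0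

/-- The TD error `δ_k = r(S_k,A_k) + γ·V̂(S_{k+1}) − V̂(S_k)`. -/
noncomputable def td (r : S → A → ℝ) (γ : ℝ) (V : S → ℝ) (s : S) {N : ℕ}
    (τ : Traj S A N) (k : ℕ) : ℝ :=
  r (st s τ k) (ac τ k) + γ * V (st s τ (k + 1)) - V (st s τ k)

/-- `p_k(s'|s,a) = P_π(S_k = s' | S_0 = s, A_0 = a)
  = P_π(A_0 = a, S_k = s' | S_0 = s) / π(a|s)`. -/
noncomputable def pkSA (π : S → A → ℝ) (P : S → A → S → ℝ) (s : S) (N k : ℕ)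
    (a : A) (s' : S) : ℝ :=
  prE π P s N (fun τ => ac τ 0 = a ∧ st s τ k = s') / π s a

/-- `p_k(s'|s) = Σ_a π(a|s)·p_k(s'|s,a)`. -/
noncomputable def pkS (π : S → A → ℝ) (P : S → A → S → ℝ) (s : S) (N k : ℕ)
    (s' : S) : ℝ :=
  ∑ a : A, π s a * pkSA π P s N k a s'

/-- The hindsight probability `p_k(a|s,s')`, defined as
`P_π(A_0 = a, S_k = s' | S_0 = s)/p_k(s'|s)` when `p_k(s'|s) > 0` and `0` otherwise. -/
noncomputable def pkA (π : S → A → ℝ) (P : S → A → S → ℝ) (s : S) (N k : ℕ)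
    (a : A) (s' : S) : ℝ :=
  if 0 < pkS π P s N k s' then
    prE π P s N (fun τ => ac τ 0 = a ∧ st s τ k = s') / pkS π P s N k s'
  else 0

/-- The `N`-step Monte-Carlo advantage estimator
`Â^MC_N(a) = (1(A_0=a)/π(a|s))·Σ_{k=0}^{N−1} γ^k·δ_k`. -/
noncomputable def mcEst (π : S → A → ℝ) (r : S → A → ℝ) (γ : ℝ) (V : S → ℝ)
    (s : S) (N : ℕ) (a : A) (τ : Traj S A N) : ℝ :=
  ((if ac τ 0 = a then (1 : ℝ) else 0) / π s a) * ∑ k ∈ range N, γ ^ k * td r γ V s τ k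

/-- The `N`-step δHCA advantage estimator
`Â^δHCA_N(a) = (1(A_0=a)/π(a|s))·δ_0 + Σ_{k=1}^{N−1} γ^k·(p_k(a|s,S_k)/π(a|s))·δ_k`. -/
noncomputable def dhcaEst (π : S → A → ℝ) (P : S → A → S → ℝ) (r : S → A → ℝ)
    (γ : ℝ) (V : S → ℝ) (s : S) (N : ℕ) (a : A) (τ : Traj S A N) : ℝ :=
  ((if ac τ 0 = a then (1 : ℝ) else 0) / π s a) * td r γ V s τ 0
    + ∑ k ∈ Ico 1 N, γ ^ k * (pkA π P s N k a (st s τ k) / π s a) * td r γ V s τ k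

/-- `V` satisfies the Bellman equation for `π`:
`V(s₀) = Σ_a π(a|s₀)·(r(s₀,a) + γ·Σ_{s'} P(s'|s₀,a)·V(s'))` for every state `s₀`. -/
def IsBellman (π : S → A → ℝ) (P : S → A → S → ℝ) (r : S → A → ℝ) (γ : ℝ)
    (V : S → ℝ) : Prop :=
  ∀ s₀ : S, V s₀ = ∑ a : A, π s₀ a * (r s₀ a + γ * ∑ s' : S, P s₀ a s' * V s')

/-- The conditional second moment `E_π[δ_k² | S_0 = s, S_k = s']`,
defined as `(Σ_{τ : S_k = s'} P_π(τ)·δ_k(τ)²)/p_k(s'|s)`. -/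
noncomputable def sndMom (π : S → A → ℝ) (P : S → A → S → ℝ) (r : S → A → ℝ)
    (γ : ℝ) (V : S → ℝ) (s : S) (N k : ℕ) (s' : S) : ℝ :=
  (∑ τ : Traj S A N, if st s τ k = s' then trajP π P s N τ * (td r γ V s τ k) ^ 2 else 0)
    / pkS π P s N k s'

/-- Prepend a step to a trajectory. -/
def consT {N : ℕ} (p : (A × S) × Traj S A N) : Traj S A (N + 1) :=
  (Fin.cons p.1.1 p.2.1, Fin.cons p.1.2 p.2.2)

/-- Trajectories split into the first step and the rest. -/
def consE (S A : Type*) (N : ℕ) : ((A × S) × Traj S A N) ≃ Traj S A (N + 1) where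
  toFun := consT
  invFun τ := ((τ.1 0, τ.2 0), (Fin.tail τ.1, Fin.tail τ.2))
  left_inv p := by simp [consT]
  right_inv τ := by simp [consT]

theorem st_consT {N : ℕ} (s x : S) (b : A) (τ : Traj S A N) (k : ℕ) (hk : k ≤ N) :
    st s (consT ((b, x), τ)) (k + 1) = st x τ k := by
  cases k with
  | zero => simp [st, consT]
  | succ k =>
    have h1 : k < N := hk
    have h2 : k + 1 < N + 1 := by omega
    simp only [st, h1, h2, dif_pos, consT]
    exact Fin.cons_succ (α := fun _ => S) x τ.2 ⟨k, h1⟩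

theorem ac_consT {N : ℕ} (x : S) (b : A) (τ : Traj S A N) (k : ℕ) (hk : k < N) :
    ac (consT ((b, x), τ)) (k + 1) = ac τ k := by
  have h2 : k + 1 < N + 1 := by omega
  simp only [ac, hk, h2, dif_pos, consT]
  exact Fin.cons_succ (α := fun _ => A) b τ.1 ⟨k, hk⟩

theorem ac_consT_zero {N : ℕ} (x : S) (b : A) (τ : Traj S A N) :
    ac (consT ((b, x), τ)) 0 = b := by
  simp [ac, consT]

theorem trajP_consT (π : S → A → ℝ) (P : S → A → S → ℝ) (s x : S) (b : A) (N : ℕ)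
    (τ : Traj S A N) :
    trajP π P s (N + 1) (consT ((b, x), τ)) = π s b * P s b x * trajP π P x N τ := by
  unfold trajP
  rw [Fin.prod_univ_succ]
  refine congrArg₂ (· * ·) ?_ ?_
  · have h : st s (consT ((b, x), τ)) (0 + 1) = x := st_consT s x b τ 0 (Nat.zero_le _)
    change π s b * P s b (st s (consT ((b, x), τ)) (0 + 1)) = _
    rw [h]
  · refine Finset.prod_congr rfl fun i _ => ?_
    have h1 := st_consT s x b τ i i.2.le
    have h2 := st_consT s x b τ (i + 1) i.2
    simp only [Fin.val_succ, h1, h2]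
    simp [consT]

theorem expct_succ (π : S → A → ℝ) (P : S → A → S → ℝ) (s : S) (N : ℕ)
    (f : Traj S A (N + 1) → ℝ) :
    expct π P s (N + 1) f
      = ∑ b : A, ∑ x : S, π s b * P s b x * expct π P x N (fun τ => f (consT ((b, x), τ))) := by
  unfold expct
  rw [← (consE S A N).sum_comp, Fintype.sum_prod_type, Fintype.sum_prod_type]
  refine Finset.sum_congr rfl fun b _ => Finset.sum_congr rfl fun x _ => ?_
  rw [Finset.mul_sum]
  refine Finset.sum_congr rfl fun τ _ => ?_
  change trajP π P s (N + 1) (consT ((b, x), τ)) * f (consT ((b, x), τ)) = _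
  rw [trajP_consT]; ring

theorem expct_const (π : S → A → ℝ) (P : S → A → S → ℝ)
    (hπsum : ∀ s₀ : S, ∑ a : A, π s₀ a = 1)
    (hPsum : ∀ (s₀ : S) (a : A), ∑ s' : S, P s₀ a s' = 1) (c : ℝ) (N : ℕ) :
    ∀ s : S, expct π P s N (fun _ => c) = c := by
  induction N with
  | zero => intro s; simp [expct, trajP]
  | succ N ih =>
    intro s
    rw [expct_succ]
    simp only [ih, ← Finset.sum_mul, ← Finset.mul_sum, hPsum, mul_one, hπsum, one_mul]

/-- One-step conditional expectation. -/
noncomputable def oneStep (π : S → A → ℝ) (P : S → A → S → ℝ) (F : S → A → S → ℝ) (x : S) : ℝ :=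
  ∑ b : A, ∑ y : S, π x b * P x b y * F x b y

theorem expct_step (π : S → A → ℝ) (P : S → A → S → ℝ)
    (hπsum : ∀ s₀ : S, ∑ a : A, π s₀ a = 1)
    (hPsum : ∀ (s₀ : S) (a : A), ∑ s' : S, P s₀ a s' = 1) (F : S → A → S → ℝ) (N : ℕ) :
    ∀ (s : S) (k : ℕ), k < N →
      expct π P s N (fun τ => F (st s τ k) (ac τ k) (st s τ (k + 1)))
        = expct π P s N (fun τ => oneStep π P F (st s τ k)) := by
  induction N with
  | zero => intro s k hk; omega
  | succ N ih =>
    intro s k hk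
    cases k with
    | zero =>
      have e : (fun τ : Traj S A (N + 1) => oneStep π P F (st s τ 0))
          = fun _ => oneStep π P F s := rfl
      rw [e, expct_const π P hπsum hPsum, expct_succ]
      unfold oneStep
      refine Finset.sum_congr rfl fun b _ => Finset.sum_congr rfl fun x _ => ?_
      congr 1
      have e2 : (fun τ : Traj S A N => F (st s (consT ((b, x), τ)) 0) (ac (consT ((b, x), τ)) 0)
          (st s (consT ((b, x), τ)) (0 + 1))) = fun _ => F s b x := by
        funext τ
        rw [st_consT s x b τ 0 (Nat.zero_le _), ac_consT_zero]
        rfl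
      rw [e2, expct_const π P hπsum hPsum]
    | succ k =>
      have hk' : k < N := by omega
      rw [expct_succ, expct_succ]
      refine Finset.sum_congr rfl fun b _ => Finset.sum_congr rfl fun x _ => ?_
      congr 1
      have := ih x k hk'
      simp only [st_consT s x b _ k hk'.le, st_consT s x b _ (k + 1) hk', ac_consT x b _ k hk']
      exact this

theorem expct_step_ind (π : S → A → ℝ) (P : S → A → S → ℝ)
    (hπsum : ∀ s₀ : S, ∑ a : A, π s₀ a = 1)
    (hPsum : ∀ (s₀ : S) (a : A), ∑ s' : S, P s₀ a s' = 1) (F : S → A → S → ℝ) (g : A → ℝ) (N : ℕ)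
    (s : S) (k : ℕ) (hk1 : 1 ≤ k) (hk : k < N) :
      expct π P s N (fun τ => g (ac τ 0) * F (st s τ k) (ac τ k) (st s τ (k + 1)))
        = expct π P s N (fun τ => g (ac τ 0) * oneStep π P F (st s τ k)) := by
  obtain ⟨k, rfl⟩ := Nat.exists_eq_add_of_le' hk1
  obtain ⟨N, rfl⟩ : ∃ M, N = M + 1 := ⟨N - 1, by omega⟩
  have hk' : k < N := by omega
  rw [expct_succ, expct_succ]
  refine Finset.sum_congr rfl fun b _ => Finset.sum_congr rfl fun x _ => ?_
  congr 1
  have := expct_step π P hπsum hPsum F N x k hk'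
  simp only [st_consT s x b _ k hk'.le, st_consT s x b _ (k + 1) hk', ac_consT x b _ k hk',
    ac_consT_zero]
  unfold expct at this ⊢
  simp only [mul_left_comm _ (g b), ← Finset.mul_sum]
  rw [this]

theorem trajP_nonneg (π : S → A → ℝ) (P : S → A → S → ℝ)
    (hπpos : ∀ s₀ a, 0 < π s₀ a) (hPnn : ∀ s₀ a s', 0 ≤ P s₀ a s') (s : S) (N : ℕ)
    (τ : Traj S A N) : 0 ≤ trajP π P s N τ :=
  Finset.prod_nonneg fun _ _ => mul_nonneg (hπpos _ _).le (hPnn _ _ _)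

theorem pkS_eq (π : S → A → ℝ) (P : S → A → S → ℝ)
    (hπpos : ∀ s₀ a, 0 < π s₀ a) (s : S) (N k : ℕ) (s' : S) :
    pkS π P s N k s' = expct π P s N (fun τ => if st s τ k = s' then 1 else 0) := by
  unfold pkS pkSA prE expct
  have : ∀ a : A, ∀ z : ℝ, π s a * (z / π s a) = z := fun a z => by
    have := (hπpos s a).ne'
    field_simp
  simp only [this]
  rw [Finset.sum_comm]
  refine Finset.sum_congr rfl fun τ _ => ?_
  by_cases h : st s τ k = s' <;> simp [h]


theorem stmt_9 {S A : Type*} [Fintype S] [Fintype A] [Nonempty S] [Nonempty A]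
    (π : S → A → ℝ) (P : S → A → S → ℝ) (r : S → A → ℝ) (γ : ℝ)
    (N : ℕ) (s : S)
    (hπpos : ∀ s₀ a, 0 < π s₀ a) (hπsum : ∀ s₀ : S, ∑ a : A, π s₀ a = 1)
    (hPnn : ∀ s₀ a s', 0 ≤ P s₀ a s') (hPsum : ∀ (s₀ : S) (a : A), ∑ s' : S, P s₀ a s' = 1)
    (hγ0 : 0 ≤ γ) (hγ1 : γ ≤ 1) (hN : 1 ≤ N)
    (V : S → ℝ) (hV : IsBellman π P r γ V)
    (a : A) (k : ℕ) (hk1 : 1 ≤ k) (hk2 : k ≤ N - 1) :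
    vr π P s N (fun τ => (if ac τ 0 = a then (1 : ℝ) else 0) / π s a * td r γ V s τ k)
      = ∑ s' : S, if 0 < pkS π P s N k s' then
          pkSA π P s N k a s' / π s a * sndMom π P r γ V s N k s' else 0 := by
  have hkN : k < N := by omega
  have hpa := (hπpos s a).ne'
  set D : S → A → S → ℝ := fun x b y => r x b + γ * V y - V x with hD
  set h2 : S → ℝ := oneStep π P (fun x b y => D x b y ^ 2) with hh2
  have hD0 : ∀ x, oneStep π P D x = 0 := by
    intro x
    have hb := hV x
    have e : oneStep π P D x
        = ∑ b : A, (π x b * (r x b + γ * ∑ y : S, P x b y * V y) - π x b * V x) := by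
      unfold oneStep
      refine Finset.sum_congr rfl fun b _ => ?_
      have e1 : ∀ y, π x b * P x b y * D x b y
          = P x b y * (π x b * (r x b - V x)) + π x b * γ * (P x b y * V y) := by
        intro y; simp only [hD]; ring
      simp only [e1, Finset.sum_add_distrib, ← Finset.sum_mul, ← Finset.mul_sum, hPsum]
      ring
    rw [e, Finset.sum_sub_distrib, ← Finset.sum_mul, hπsum, ← hb]
    ring
  have htd : ∀ τ : Traj S A N, td r γ V s τ k = D (st s τ k) (ac τ k) (st s τ (k + 1)) :=
    fun τ => rfl
  have hmean : expct π P s N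
      (fun τ => (if ac τ 0 = a then (1 : ℝ) else 0) / π s a * td r γ V s τ k) = 0 := by
    have := expct_step_ind π P hπsum hPsum D (fun b => (if b = a then (1 : ℝ) else 0) / π s a)
      N s k hk1 hkN
    simp only [htd]
    rw [this]
    simp [hD0, expct]
  have hvar : vr π P s N
      (fun τ => (if ac τ 0 = a then (1 : ℝ) else 0) / π s a * td r γ V s τ k)
      = expct π P s N
        (fun τ => ((if ac τ 0 = a then (1 : ℝ) else 0) / π s a ^ 2) * h2 (st s τ k)) := by
    unfold vr
    rw [hmean]
    have := expct_step_ind π P hπsum hPsum (fun x b y => D x b y ^ 2)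
      (fun b => (if b = a then (1 : ℝ) else 0) / π s a ^ 2) N s k hk1 hkN
    rw [← this]
    congr 1
    funext τ
    simp only [htd]
    by_cases h : ac τ 0 = a
    · simp only [h, if_true]; ring
    · simp [h]
  have hsnd : ∀ s', (∑ τ : Traj S A N,
      if st s τ k = s' then trajP π P s N τ * (td r γ V s τ k) ^ 2 else 0)
      = h2 s' * pkS π P s N k s' := by
    intro s'
    have := expct_step π P hπsum hPsum (fun x b y => if x = s' then D x b y ^ 2 else 0) N s k hkN
    rw [pkS_eq π P hπpos]
    have e1 : ∀ x, oneStep π P (fun x b y => if x = s' then D x b y ^ 2 else 0) x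
        = h2 s' * (if x = s' then 1 else 0) := by
      intro x
      by_cases h : x = s'
      · subst h; simp [oneStep, hh2]
      · simp [oneStep, h]
    simp only [e1] at this
    unfold expct at this ⊢
    rw [Finset.mul_sum]
    simp only [mul_left_comm (h2 s')]
    rw [← this]
    refine Finset.sum_congr rfl fun τ _ => ?_
    rw [htd]
    by_cases h : st s τ k = s' <;> simp [h]
  have hle : ∀ s', 0 ≤ prE π P s N (fun τ => ac τ 0 = a ∧ st s τ k = s') ∧
      prE π P s N (fun τ => ac τ 0 = a ∧ st s τ k = s') ≤ pkS π P s N k s' := by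
    intro s'
    rw [pkS_eq π P hπpos]
    unfold prE expct
    refine ⟨Finset.sum_nonneg fun τ _ => ?_, Finset.sum_le_sum fun τ _ => ?_⟩
    · have := trajP_nonneg π P hπpos hPnn s N τ
      split_ifs <;> simp [this]
    · have := trajP_nonneg π P hπpos hPnn s N τ
      by_cases h : st s τ k = s' <;> by_cases h' : ac τ 0 = a <;> simp [h, h', this]
  have hrhs : ∀ s', (if 0 < pkS π P s N k s' then
          pkSA π P s N k a s' / π s a * sndMom π P r γ V s N k s' else 0)
      = prE π P s N (fun τ => ac τ 0 = a ∧ st s τ k = s') * (h2 s' / π s a ^ 2) := by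
    intro s'
    split_ifs with h
    · unfold sndMom pkSA
      rw [hsnd, mul_div_assoc, div_self h.ne']
      field_simp
    · have := hle s'
      have h0 : prE π P s N (fun τ => ac τ 0 = a ∧ st s τ k = s') = 0 := by linarith
      rw [h0, zero_mul]
  rw [hvar]
  simp only [hrhs]
  unfold expct prE
  simp only [Finset.sum_mul]
  rw [Finset.sum_comm]
  refine Finset.sum_congr rfl fun τ _ => ?_
  rw [Finset.sum_eq_single (st s τ k)]
  · by_cases h : ac τ 0 = a
    · simp only [h, if_true, true_and]; ring
    · simp [h]
  · intro y _ hy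
    simp [hy.symm]
  · simp


end HCA
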